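/- Let γ > 0, let m = ⌈γ⌉ be the smallest natural number with m ≥ γ, let T > 0, and let x : [0, T] → ℝ be m-times continuously differentiable. Let g : [0, T] → ℝ be continuous and suppose the Caputo fractional derivative of x of order γ satisfies (CD^γ x)(t) = g(t) for all t ∈ [0, T]. Then for every t ∈ [0, T], x(t) = Σ_{k=0}^{m−1} x^{(k)}(0) · tᵏ/k! + (1/Γ(γ)) ∫₀ᵗ (t − τ)^{γ−1} g(τ) dτ; that is, x satisfies the Volterra integral representation x(t) = T_{m−1}(t) + (I^γ g)(t), where T_{m−1} is the Taylor polynomial of x of degree m − 1 at 0. -/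

import Mathlib

open Real Set MeasureTheory

/-- Riemann–Liouville fractional integral of order `α` (with base point `0`):
`(I^α f)(t) = (1/Γ(α)) ∫₀ᵗ (t − τ)^{α−1} f(τ) dτ`. -/
noncomputable def rlInt (α : ℝ) (f : ℝ → ℝ) (t : ℝ) : ℝ :=
  (1 / Real.Gamma α) * ∫ τ in (0:ℝ)..t, (t - τ) ^ (α - 1) * f τ

lemma cv_beta {a b u : ℝ} (ha : 0 < a) (hb : 0 < b) (hu : 0 < u) :
    ∫ y in (0:ℝ)..u, y ^ (a - 1) * (u - y) ^ (b - 1)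
      = u ^ (a + b - 1) * ProbabilityTheory.beta a b := by
  have h := Complex.betaIntegral_scaled (a : ℂ) (b : ℂ) hu
  rw [Complex.betaIntegral_eq_Gamma_mul_div _ _ (by simpa) (by simpa)] at h
  have e : ∫ y in (0:ℝ)..u, (y : ℂ) ^ ((a : ℂ) - 1) * ((u : ℂ) - y) ^ ((b : ℂ) - 1)
      = ∫ y in (0:ℝ)..u, ((y ^ (a - 1) * (u - y) ^ (b - 1) : ℝ) : ℂ) := by
    refine intervalIntegral.integral_congr fun y hy => ?_
    rw [uIcc_of_le hu.le] at hy
    rw [Complex.ofReal_mul, Complex.ofReal_cpow hy.1, Complex.ofReal_cpow (sub_nonneg.2 hy.2)]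
    push_cast
    rfl
  rw [e, intervalIntegral.integral_ofReal] at h
  have e2 : (u : ℂ) ^ ((a : ℂ) + b - 1) = ((u ^ (a + b - 1) : ℝ) : ℂ) := by
    rw [Complex.ofReal_cpow hu.le]; push_cast; rfl
  rw [e2, ← Complex.ofReal_add, Complex.Gamma_ofReal, Complex.Gamma_ofReal,
    Complex.Gamma_ofReal] at h
  rw [ProbabilityTheory.beta]
  exact_mod_cast h

lemma cv_beta2 {a b s t : ℝ} (ha : 0 < a) (hb : 0 < b) (hst : s < t) :
    ∫ τ in s..t, (t - τ) ^ (a - 1) * (τ - s) ^ (b - 1)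
      = (t - s) ^ (a + b - 1) * ProbabilityTheory.beta a b := by
  rw [← cv_beta ha hb (sub_pos.2 hst)]
  have := intervalIntegral.integral_comp_sub_left
    (fun y : ℝ => y ^ (a - 1) * ((t - s) - y) ^ (b - 1)) t (a := s) (b := t)
  rw [sub_self] at this
  rw [← this]
  refine intervalIntegral.integral_congr fun y _ => ?_
  congr 2
  ring

lemma cv_int {a b s t : ℝ} (ha : 0 < a) (hb : 0 < b) (hst : s < t) :
    IntervalIntegrable (fun τ => (t - τ) ^ (a - 1) * (τ - s) ^ (b - 1)) volume s t := by
  by_contra h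
  have h1 := intervalIntegral.integral_undef h
  rw [cv_beta2 ha hb hst] at h1
  have := Real.rpow_pos_of_pos (sub_pos.2 hst) (a + b - 1)
  have := ProbabilityTheory.beta_pos ha hb
  have : 0 < (t - s) ^ (a + b - 1) * ProbabilityTheory.beta a b := by positivity
  linarith

lemma cv_semi {a b t : ℝ} (ha : 0 < a) (hb : 0 < b) (ht : 0 < t) {f : ℝ → ℝ}
    (hf : ContinuousOn f (Icc 0 t)) :
    ∫ τ in (0:ℝ)..t, (t - τ) ^ (a - 1) * ∫ s in (0:ℝ)..τ, (τ - s) ^ (b - 1) * f s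
      = ProbabilityTheory.beta a b * ∫ s in (0:ℝ)..t, (t - s) ^ (a + b - 1) * f s := by
  set μ : Measure ℝ := volume.restrict (Ioc 0 t) with hμ
  set F : ℝ → ℝ → ℝ := fun s τ => f s *
    (Ioi s).indicator (fun τ => (t - τ) ^ (a - 1) * (τ - s) ^ (b - 1)) τ with hF
  have hmem : ∀ᵐ s ∂μ, s ∈ Ioo 0 t := by
    rw [hμ, ← restrict_Ioo_eq_restrict_Ioc]
    exact ae_restrict_mem measurableSet_Ioo
  have hset : ∀ s ∈ Ioo 0 t, Ioc 0 t ∩ Ioi s = Ioc s t := by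
    intro s hs
    ext τ
    simp only [mem_inter_iff, mem_Ioc, mem_Ioi]
    constructor
    · rintro ⟨⟨_, h⟩, h'⟩; exact ⟨h', h⟩
    · rintro ⟨h, h'⟩; exact ⟨⟨hs.1.trans h, h'⟩, h⟩
  have hI : ∀ s ∈ Ioo 0 t, Integrable
      ((Ioi s).indicator (fun τ => (t - τ) ^ (a - 1) * (τ - s) ^ (b - 1))) μ := by
    intro s hs
    rw [integrable_indicator_iff measurableSet_Ioi, IntegrableOn, hμ,
      Measure.restrict_restrict measurableSet_Ioi, inter_comm, hset s hs]
    exact (intervalIntegrable_iff_integrableOn_Ioc_of_le hs.2.le).1 (cv_int ha hb hs.2)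
  have hV : ∀ s ∈ Ioo 0 t, ∫ τ, 
      (Ioi s).indicator (fun τ => (t - τ) ^ (a - 1) * (τ - s) ^ (b - 1)) τ ∂μ
        = (t - s) ^ (a + b - 1) * ProbabilityTheory.beta a b := by
    intro s hs
    rw [integral_indicator measurableSet_Ioi, hμ,
      Measure.restrict_restrict measurableSet_Ioi, inter_comm, hset s hs,
      ← intervalIntegral.integral_of_le hs.2.le, cv_beta2 ha hb hs.2]
  have hfm : AEStronglyMeasurable f μ :=
    (hf.mono Ioc_subset_Icc_self).aestronglyMeasurable measurableSet_Ioc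
  have hFm : AEStronglyMeasurable (Function.uncurry F) (μ.prod μ) := by
    refine hfm.comp_fst.mul ?_
    have : Measurable (fun p : ℝ × ℝ => ({p : ℝ × ℝ | p.1 < p.2}).indicator
        (fun p : ℝ × ℝ => (t - p.2) ^ (a - 1) * (p.2 - p.1) ^ (b - 1)) p) := by
      refine Measurable.indicator (by fun_prop) ?_
      exact measurableSet_lt measurable_fst measurable_snd
    exact this.aestronglyMeasurable
  have hpow : IntervalIntegrable (fun s => (t - s) ^ (a + b - 1)) volume 0 t := by
    have := (intervalIntegral.intervalIntegrable_rpow' (a := t) (b := 0)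
      (show -1 < a + b - 1 by linarith)).comp_sub_left t
    simpa using this
  have hFi : Integrable (Function.uncurry F) (μ.prod μ) := by
    rw [integrable_prod_iff hFm]
    constructor
    · filter_upwards [hmem] with s hs
      exact (hI s hs).const_mul (f s)
    · have h1 : IntervalIntegrable (fun s => (t - s) ^ (a + b - 1) * (|f s| * ProbabilityTheory.beta a b))
          volume 0 t := by
        refine hpow.mul_continuousOn ?_
        rw [uIcc_of_le ht.le]
        exact hf.abs.mul continuousOn_const
      refine (((intervalIntegrable_iff_integrableOn_Ioc_of_le ht.le).1 h1)).congr ?_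
      filter_upwards [hmem] with s hs
      have : ∀ᵐ τ ∂μ, ‖Function.uncurry F (s, τ)‖ = |f s| * 
          (Ioi s).indicator (fun τ => (t - τ) ^ (a - 1) * (τ - s) ^ (b - 1)) τ := by
        filter_upwards [hmem] with τ hτ
        simp only [Function.uncurry, hF, norm_mul, Real.norm_eq_abs]
        congr 1
        refine abs_of_nonneg (indicator_apply_nonneg ?_)
        intro h
        have h1 : 0 ≤ t - τ := by linarith [hτ.2]
        have h2 : 0 ≤ τ - s := by linarith [mem_Ioi.1 h]
        positivity
      rw [integral_congr_ae this, integral_const_mul, hV s hs]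
      ring
  have hsw := integral_integral_swap hFi
  have hL : ∫ s, ∫ τ, F s τ ∂μ ∂μ
      = ProbabilityTheory.beta a b * ∫ s in (0:ℝ)..t, (t - s) ^ (a + b - 1) * f s := by
    rw [intervalIntegral.integral_of_le ht.le, ← integral_const_mul]
    refine integral_congr_ae ?_
    filter_upwards [hmem] with s hs
    rw [integral_const_mul, hV s hs]
    ring
  rw [← hL, hsw, intervalIntegral.integral_of_le ht.le]
  refine integral_congr_ae ?_
  filter_upwards [hmem] with τ hτ
  have e : ∀ s, F s τ = (Iio τ).indicator
      (fun s => (t - τ) ^ (a - 1) * ((τ - s) ^ (b - 1) * f s)) s := by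
    intro s
    by_cases h : s < τ
    · simp [hF, h]; ring
    · simp [hF, h]
  simp only [e]
  rw [integral_indicator measurableSet_Iio, hμ, Measure.restrict_restrict measurableSet_Iio,
    intervalIntegral.integral_of_le hτ.1.le, ← restrict_Ioo_eq_restrict_Ioc, ← integral_const_mul]
  congr 2
  ext s
  simp only [mem_inter_iff, mem_Ioc, mem_Iio, mem_Ioo]
  constructor
  · rintro ⟨h, h'⟩; exact ⟨h', h, h'.le.trans hτ.2.le⟩
  · rintro ⟨h, h'⟩; exact ⟨h'.1, h⟩

lemma cv_rl_semi {a b t : ℝ} (ha : 0 < a) (hb : 0 < b) (ht : 0 < t) {f : ℝ → ℝ}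
    (hf : ContinuousOn f (Icc 0 t)) :
    rlInt a (rlInt b f) t = rlInt (a + b) f t := by
  unfold rlInt
  have h := cv_semi ha hb ht hf
  have e : ∀ τ, (t - τ) ^ (a - 1) * (1 / Real.Gamma b * ∫ s in (0:ℝ)..τ, (τ - s) ^ (b - 1) * f s)
     = 1 / Real.Gamma b * ((t - τ) ^ (a - 1) * ∫ s in (0:ℝ)..τ, (τ - s) ^ (b - 1) * f s) := by
    intro τ; ring
  simp only [e]
  rw [intervalIntegral.integral_const_mul, h, ProbabilityTheory.beta]
  have := (Real.Gamma_pos_of_pos ha).ne'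
  have := (Real.Gamma_pos_of_pos hb).ne'
  have := (Real.Gamma_pos_of_pos (add_pos ha hb)).ne'
  field_simp

lemma cv_congr {a t : ℝ} (ht : 0 ≤ t) {f g : ℝ → ℝ} (h : ∀ s ∈ Icc 0 t, f s = g s) :
    rlInt a f t = rlInt a g t := by
  unfold rlInt
  congr 1
  refine intervalIntegral.integral_congr fun s hs => ?_
  rw [uIcc_of_le ht] at hs
  simp only [h s hs]

lemma cv_taylor {n : ℕ} {T t : ℝ} {x : ℝ → ℝ} (ht : 0 < t) (htT : t ≤ T)
    (hx : ContDiffOn ℝ (n + 1 : ℕ) x (Icc 0 T)) :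
    x t = (∑ k ∈ Finset.range (n + 1),
              iteratedDerivWithin k x (Icc 0 T) 0 * t ^ k / (Nat.factorial k))
            + rlInt ((n + 1 : ℕ) : ℝ) (iteratedDerivWithin (n + 1) x (Icc 0 T)) t := by
  have key : ∀ k : ℕ, ∀ s ∈ Ico 0 t,
      iteratedDerivWithin k x (Icc 0 t) s = iteratedDerivWithin k x (Icc 0 T) s := by
    intro k s hs
    unfold iteratedDerivWithin
    congr 1
    refine iteratedFDerivWithin_congr_set ?_ k
    filter_upwards [Iio_mem_nhds hs.2] with y hy
    have hy' : y < t := hy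
    apply propext
    show (0 ≤ y ∧ y ≤ t) ↔ (0 ≤ y ∧ y ≤ T)
    exact ⟨fun h => ⟨h.1, h.2.trans htT⟩, fun h => ⟨h.1, hy'.le⟩⟩
  have h := taylor_integral_remainder (f := x) (x := t) (x₀ := 0) (n := n)
    (hx.mono (by rw [uIcc_of_le ht.le]; exact Icc_subset_Icc_right htT))
  rw [taylor_within_apply, uIcc_of_le ht.le, sub_eq_iff_eq_add'] at h
  rw [h]
  congr 1
  · refine Finset.sum_congr rfl fun k _ => ?_
    rw [key k 0 ⟨le_rfl, ht⟩, sub_zero, smul_eq_mul]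
    field_simp
  · unfold rlInt
    rw [← intervalIntegral.integral_const_mul]
    refine intervalIntegral.integral_congr_uIoo fun s hs => ?_
    rw [uIoo_of_le ht.le] at hs
    rw [key (n + 1) s ⟨hs.1.le, hs.2⟩, smul_eq_mul]
    push_cast
    rw [Real.Gamma_nat_eq_factorial, add_sub_cancel_right, Real.rpow_natCast]
    field_simp

/-- Volterra integral representation for Caputo fractional differential equations:
if `γ > 0`, `m = ⌈γ⌉`, `x : [0,T] → ℝ` is `m`-times continuously differentiable,
`g` is continuous and `(CD^γ x)(t) = g(t)` on `[0,T]` — where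
`CD^γ x = I^{m−γ} x^{(m)}`, interpreted as `x^{(m)}` itself when `γ = m` — then
`x(t) = Σ_{k=0}^{m−1} x^{(k)}(0) tᵏ/k! + (I^γ g)(t)` for all `t ∈ [0,T]`. -/
theorem caputo_volterra_representation (γ T : ℝ) (hγ : 0 < γ) (hT : 0 < T)
    (x g : ℝ → ℝ)
    (hx : ContDiffOn ℝ (⌈γ⌉₊ : ℕ∞) x (Set.Icc 0 T))
    (hg : ContinuousOn g (Set.Icc 0 T))
    (hcap : ∀ t ∈ Set.Icc (0:ℝ) T,
      (if γ = (⌈γ⌉₊ : ℝ) then iteratedDerivWithin ⌈γ⌉₊ x (Set.Icc 0 T) t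
        else rlInt ((⌈γ⌉₊ : ℝ) - γ) (iteratedDerivWithin ⌈γ⌉₊ x (Set.Icc 0 T)) t)
        = g t) :
    ∀ t ∈ Set.Icc (0:ℝ) T,
      x t = (∑ k ∈ Finset.range ⌈γ⌉₊,
              iteratedDerivWithin k x (Set.Icc 0 T) 0 * t ^ k / (Nat.factorial k))
            + rlInt γ g t := by
  obtain ⟨n, hn⟩ : ∃ n, ⌈γ⌉₊ = n + 1 := Nat.exists_eq_succ_of_ne_zero (Nat.ceil_pos.2 hγ).ne'
  have hle : γ ≤ (⌈γ⌉₊ : ℝ) := Nat.le_ceil γ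
  rw [hn] at hx hcap hle ⊢
  have hx' : ContDiffOn ℝ (n + 1 : ℕ) x (Icc 0 T) := by exact_mod_cast hx
  intro t ht
  rcases ht.1.eq_or_lt with h0 | h0
  · subst h0
    rw [Finset.sum_range_succ']
    simp [rlInt]
  rw [cv_taylor h0 ht.2 hx']
  congr 1
  have hsub : Icc 0 t ⊆ Icc 0 T := Icc_subset_Icc_right ht.2
  by_cases hc : γ = ((n + 1 : ℕ) : ℝ)
  · rw [← hc]
    refine cv_congr h0.le fun s hs => ?_
    have := hcap s (hsub hs)
    rwa [if_pos hc] at this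
  · have hlt : 0 < ((n + 1 : ℕ) : ℝ) - γ := sub_pos.2 (lt_of_le_of_ne hle hc)
    have hcont : ContinuousOn (iteratedDerivWithin (n + 1) x (Icc 0 T)) (Icc 0 t) :=
      (hx'.continuousOn_iteratedDerivWithin le_rfl (uniqueDiffOn_Icc hT)).mono hsub
    have h2 := cv_rl_semi hγ hlt h0 hcont
    rw [add_sub_cancel] at h2
    rw [← h2]
    refine cv_congr h0.le fun s hs => ?_
    have := hcap s (hsub hs)
    rwa [if_neg hc] at this
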